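/- arXiv:2002.09308 — 3 statements merged into one kernel-verified Lean document; each statement's English description precedes it below -/
import Mathlib

section
/- Let G be a group, X a Baire topological space, and let G act on X so that for each g ∈ G the map x ↦ g·x is continuous. Let U ⊆ X be a nonempty open set and let B ⊆ U be comeager in U. Then the return set of U is contained in the return set of B: for every g ∈ G, if U ∩ gU ≠ ∅ then B ∩ gB ≠ ∅. -/
open Pointwise

/-- The return set of `Y ⊆ X` under an action of `G`: the set of `g ∈ G` with `Y ∩ gY ≠ ∅`. -/
def returnSet (G : Type*) {X : Type*} [Group G] [MulAction G X] (Y : Set X) : Set G :=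
  {g : G | (Y ∩ g • Y).Nonempty}

/-- `B` is comeager in `C` (i.e. `C \ B` is meager in the subspace topology on `C`). -/
def ComeagerIn {X : Type*} [TopologicalSpace X] (B C : Set X) : Prop :=
  ((↑) : C → X) ⁻¹' B ∈ residual C

/-- If `G` is a group acting on a Baire space `X` so that each map
`x ↦ g • x` is continuous, `U ⊆ X` is nonempty open, and `B ⊆ U` is comeager in `U`,
then the return set of `U` is contained in the return set of `B`. -/
theorem stmt2 {G X : Type*} [Group G] [TopologicalSpace X] [BaireSpace X] [MulAction G X]
    (hact : ∀ g : G, Continuous fun x : X => g • x)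
    (U : Set X) (hUopen : IsOpen U) (hUne : U.Nonempty)
    (B : Set X) (hBU : B ⊆ U) (hB : ComeagerIn B U) :
    returnSet G U ⊆ returnSet G B := by
  intro g hg
  have hsub : (U ∩ g • U).Nonempty := hg
  have hV : IsOpen (U ∩ g • U) := by
    refine hUopen.inter ?_
    rw [← Set.preimage_smul_inv]
    exact hUopen.preimage (hact g⁻¹)
  set V := U ∩ g • U with hVdef
  have : BaireSpace V := hV.baireSpace
  have : Nonempty V := hsub.to_subtype
  let h : X ≃ₜ X :=
    { MulAction.toPerm g⁻¹ with
      continuous_toFun := hact g⁻¹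
      continuous_invFun := by
        have := hact (g⁻¹)⁻¹
        exact this }
  let i : V → U := fun x => ⟨x.1, x.2.1⟩
  let j : V → U := fun x => ⟨g⁻¹ • x.1, Set.mem_smul_set_iff_inv_smul_mem.1 x.2.2⟩
  have hi : Continuous i := continuous_subtype_val.subtype_mk _
  have hj : Continuous j := ((hact g⁻¹).comp continuous_subtype_val).subtype_mk _
  have hio : IsOpenMap i := by
    have h1 : IsOpenMap (Subtype.val ∘ i) := hV.isOpenMap_subtype_val
    intro W hW
    have h2 := (h1 W hW).preimage (continuous_subtype_val (p := fun x => x ∈ U))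
    rwa [Set.image_comp, Set.preimage_image_eq _ Subtype.val_injective] at h2
  have hjo : IsOpenMap j := by
    have h1 : IsOpenMap (Subtype.val ∘ j) := h.isOpenMap.comp hV.isOpenMap_subtype_val
    intro W hW
    have h2 := (h1 W hW).preimage (continuous_subtype_val (p := fun x => x ∈ U))
    rwa [Set.image_comp, Set.preimage_image_eq _ Subtype.val_injective] at h2
  have h1 := tendsto_residual_of_isOpenMap hi hio hB
  have h2 := tendsto_residual_of_isOpenMap hj hjo hB
  obtain ⟨x, hx1, hx2⟩ := (dense_of_mem_residual (Filter.inter_mem h1 h2)).nonempty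
  exact ⟨x.1, hx1, Set.mem_smul_set_iff_inv_smul_mem.2 hx2⟩
end

section
/- Let G be a group, X a Baire topological space, let 𝓕 ⊆ 𝒫(G) be upward closed (S ∈ 𝓕 and S ⊆ T imply T ∈ 𝓕), and let G act on X so that for each g ∈ G the map x ↦ g·x is continuous and the action is 𝓕-recurrent, i.e., R(U) ∈ 𝓕 for every nonempty open U ⊆ X. Then for every nonmeager set B ⊆ X with the Baire property, R(B) ∈ 𝓕. -/
open Pointwise

/-- If `G` is a group acting on a Baire space `X` so that each map
`x ↦ g • x` is continuous, `𝓕 ⊆ 𝒫(G)` is upward closed, and the action is `𝓕`-recurrent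
(the return set of every nonempty open set is in `𝓕`), then the return set of every
nonmeager set with the Baire property is in `𝓕`. -/
theorem stmt3 {G X : Type*} [Group G] [TopologicalSpace X] [BaireSpace X] [MulAction G X]
    (𝓕 : Set (Set G)) (h𝓕 : ∀ S T : Set G, S ∈ 𝓕 → S ⊆ T → T ∈ 𝓕)
    (hact : ∀ g : G, Continuous fun x : X => g • x)
    (hrec : ∀ U : Set X, IsOpen U → U.Nonempty → returnSet G U ∈ 𝓕)
    (B : Set X) (hBnm : ¬ IsMeagre B) (hBbp : BaireMeasurableSet B) :
    returnSet G B ∈ 𝓕 := by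
  obtain ⟨U, hU, hBU⟩ := hBbp.residualEq_isOpen
  have hne : U.Nonempty := by
    by_contra h
    rw [Set.not_nonempty_iff_eq_empty] at h
    subst h
    apply hBnm
    have h2 : ∀ᶠ x in residual X, (x ∈ B) = (x ∈ (∅ : Set X)) := hBU
    change Bᶜ ∈ residual X
    filter_upwards [h2] with x hx
    simpa using hx
  refine h𝓕 _ _ (hrec U hU hne) ?_
  intro g hg
  have h2 : ∀ᶠ x in residual X, (x ∈ B) = (x ∈ U) := hBU
  have hopen : IsOpenMap fun x : X => g⁻¹ • x := by
    intro V hV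
    have : (fun x : X => g⁻¹ • x) '' V = (fun x : X => g • x) ⁻¹' V := by
      ext x
      constructor
      · rintro ⟨y, hy, rfl⟩
        simpa using hy
      · intro hx
        exact ⟨g • x, hx, by simp⟩
    rw [this]
    exact hV.preimage (hact g)
  have h3 := (tendsto_residual_of_isOpenMap (hact g⁻¹) hopen).eventually h2
  have hd := dense_of_mem_residual (h2.and h3)
  have hW : IsOpen (U ∩ (fun x : X => g⁻¹ • x) ⁻¹' U) := hU.inter (hU.preimage (hact g⁻¹))
  obtain ⟨y, hyU, hygU⟩ := hg
  obtain ⟨x, ⟨hxU, hxgU⟩, hx1, hx2⟩ := hd.inter_open_nonempty _ hW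
    ⟨y, hyU, Set.mem_smul_set_iff_inv_smul_mem.1 hygU⟩
  exact ⟨x, hx1.mpr hxU, Set.mem_smul_set_iff_inv_smul_mem.2 (hx2.mpr hxgU)⟩
end

section
/- Let X be a second-countable Baire topological space and let E be an equivalence relation on X such that every E-equivalence class, with the subspace topology, is a Baire space, and the E-saturation of every open subset of X is open. Let B ⊆ X have the Baire property. Then: (1) the set of x ∈ X such that B ∩ [x]_E has the Baire property in the subspace [x]_E is comeager in X; (2) B is comeager in X if and only if the set of x ∈ X such that B ∩ [x]_E is comeager in the subspace [x]_E is comeager in X. -/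
open Pointwise

theorem aux_dense_open {X : Type*} [TopologicalSpace X] [SecondCountableTopology X]
    (E : X → X → Prop) (hE : Equivalence E)
    (hsat : ∀ U : Set X, IsOpen U → IsOpen {x : X | ∃ y ∈ U, E x y})
    (D : Set X) (hD : IsOpen D) (hd : Dense D) :
    {x : X | Dense (((↑) : {y : X | E x y} → X) ⁻¹' D)} ∈ residual X := by
  have key : ∀ U ∈ TopologicalSpace.countableBasis X,
      {x : X | (∃ y ∈ U, E x y) → ∃ y ∈ U ∩ D, E x y} ∈ residual X := by
    intro U hU
    have hUo := TopologicalSpace.isOpen_of_mem_countableBasis hU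
    have ho : IsOpen ({x : X | ∃ y ∈ U ∩ D, E x y} ∪ interior {x : X | ∃ y ∈ U, E x y}ᶜ) :=
      (hsat _ (hUo.inter hD)).union isOpen_interior
    refine Filter.mem_of_superset (residual_of_dense_open ho ?_) ?_
    · rw [dense_iff_inter_open]
      intro V hV hVne
      by_cases h : ∃ v ∈ V, ∃ y ∈ U, E v y
      · obtain ⟨v, hv, y, hy, hvy⟩ := h
        obtain ⟨z, ⟨hzU, w, hw, hzw⟩, hzD⟩ := dense_iff_inter_open.1 hd _ (hUo.inter (hsat V hV))
          ⟨y, hy, v, hv, hE.symm hvy⟩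
        exact ⟨w, hw, Or.inl ⟨z, ⟨hzU, hzD⟩, hE.symm hzw⟩⟩
      · obtain ⟨v, hv⟩ := hVne
        refine ⟨v, hv, Or.inr (mem_interior.2 ⟨V, ?_, hV, hv⟩)⟩
        intro w hw hw'
        exact h ⟨w, hw, hw'⟩
    · rintro x (hx | hx) hx'
      · exact hx
      · exact absurd hx' (interior_subset hx)
  have := (countable_bInter_mem (TopologicalSpace.countable_countableBasis X)).2 key
  refine Filter.mem_of_superset this ?_
  intro x hx
  simp only [Set.mem_iInter] at hx
  show Dense _
  rw [dense_iff_inter_open]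
  rintro V hV ⟨⟨y, hxy⟩, hy⟩
  obtain ⟨W, hW, rfl⟩ := isOpen_induced_iff.1 hV
  obtain ⟨U, hU, hyU, hUW⟩ :=
    (TopologicalSpace.isBasis_countableBasis X).exists_subset_of_mem_open hy hW
  obtain ⟨z, ⟨hzU, hzD⟩, hxz⟩ := hx U hU ⟨y, hyU, hxy⟩
  exact ⟨⟨z, hxz⟩, hUW hzU, hzD⟩

theorem aux_residual {X : Type*} [TopologicalSpace X] [SecondCountableTopology X]
    (E : X → X → Prop) (hE : Equivalence E)
    (hsat : ∀ U : Set X, IsOpen U → IsOpen {x : X | ∃ y ∈ U, E x y})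
    (R : Set X) (hR : R ∈ residual X) :
    {x : X | ComeagerIn R {y : X | E x y}} ∈ residual X := by
  obtain ⟨S, hSo, hSd, hSc, hSR⟩ := mem_residual_iff.1 hR
  have := (countable_bInter_mem hSc).2
    (fun D hD => aux_dense_open E hE hsat D (hSo D hD) (hSd D hD))
  refine Filter.mem_of_superset this ?_
  intro x hx
  simp only [Set.mem_iInter] at hx
  have h2 : (⋂ D ∈ S, ((↑) : {y : X | E x y} → X) ⁻¹' D) ∈ residual {y : X | E x y} :=
    (countable_bInter_mem hSc).2 (fun D hD =>
      residual_of_dense_open ((hSo D hD).preimage continuous_subtype_val) (hx D hD))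
  refine Filter.mem_of_superset h2 ?_
  intro y hy
  simp only [Set.mem_iInter] at hy
  exact hSR (Set.mem_sInter.2 hy)

/-- Let `X` be a second-countable Baire space and `E` an equivalence
relation on `X` such that every `E`-class is a Baire space in the subspace topology and the
`E`-saturation of every open set is open. Then for every set `B` with the Baire property:
(1) for comeagerly many `x`, `B ∩ [x]_E` has the Baire property in `[x]_E`; and
(2) `B` is comeager if and only if for comeagerly many `x`, `B` is comeager in `[x]_E`. -/
theorem stmt17 {X : Type*} [TopologicalSpace X] [SecondCountableTopology X] [BaireSpace X]
    (E : X → X → Prop) (hE : Equivalence E)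
    (hclassBaire : ∀ x : X, BaireSpace {y : X | E x y})
    (hsat : ∀ U : Set X, IsOpen U → IsOpen {x : X | ∃ y ∈ U, E x y})
    (B : Set X) (hB : BaireMeasurableSet B) :
    ({x : X | BaireMeasurableSet (((↑) : {y : X | E x y} → X) ⁻¹' B)} ∈ residual X) ∧
    (B ∈ residual X ↔ {x : X | ComeagerIn B {y : X | E x y}} ∈ residual X) := by
  obtain ⟨U, hU, hBU⟩ := hB.residualEq_isOpen
  have hR : {x | x ∈ B ↔ x ∈ U} ∈ residual X := Filter.eventuallyEq_set.1 hBU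
  have hR' := aux_residual E hE hsat _ hR
  refine ⟨?_, fun h => aux_residual E hE hsat B h, fun h => ?_⟩
  · refine Filter.mem_of_superset hR' ?_
    intro x hx
    refine BaireMeasurableSet.iff_residualEq_isOpen.2
      ⟨_, hU.preimage continuous_subtype_val, Filter.eventuallyEq_set.2 hx⟩
  · have hUd : Dense U := by
      rw [dense_iff_inter_open]
      rintro V hV ⟨v, hv⟩
      obtain ⟨x, ⟨w, hw, hxw⟩, hx1, hx2⟩ := dense_iff_inter_open.1
        (dense_of_mem_residual (Filter.inter_mem hR' h)) _ (hsat V hV) ⟨v, v, hv, hE.refl v⟩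
      have := hclassBaire x
      obtain ⟨z, hzV, hz1, hz2⟩ := dense_iff_inter_open.1
        (dense_of_mem_residual (Filter.inter_mem hx1 hx2)) _
        (hV.preimage continuous_subtype_val) ⟨⟨w, hxw⟩, hw⟩
      exact ⟨z, hzV, hz1.1 hz2⟩
    filter_upwards [hR, residual_of_dense_open hU hUd] with x h1 h2
    exact h1.2 h2
end
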